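/- arXiv:1907.07172 — 5 statements merged into one kernel-verified Lean document; each statement's English description precedes it below -/
import Mathlib

section
/- For every permutation π of {1,…,n+1}, the determinant of the matrix L_π is 1 or −1. -/
open MeasureTheory

noncomputable section

/-- Walk positions: `walk n x i = x 0 + ⋯ + x (i-1)` (so `walk n x 0 = 0`). -/
def walk (n : ℕ) (x : Fin n → ℝ) (i : Fin (n + 1)) : ℝ :=
  ∑ j : Fin n, if (j : ℕ) < (i : ℕ) then x j else 0

/-- The region of step tuples generating the ordinal pattern `π`. -/
def D (n : ℕ) (π : Equiv.Perm (Fin (n + 1))) : Set (Fin n → ℝ) :=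
  {x | (∀ i j : Fin (n + 1), i ≠ j → walk n x i ≠ walk n x j) ∧
       (∀ i j : Fin (n + 1), walk n x i < walk n x j ↔ π i < π j)}

/-- The matrix `L_π`. -/
def L (n : ℕ) (π : Equiv.Perm (Fin (n + 1))) : Matrix (Fin n) (Fin n) ℝ :=
  fun i j =>
    if (π i.castSucc : ℕ) ≤ (j : ℕ) ∧ (j : ℕ) < (π i.succ : ℕ) then 1
    else if (π i.succ : ℕ) ≤ (j : ℕ) ∧ (j : ℕ) < (π i.castSucc : ℕ) then -1
    else 0

/-- Partial sum `x i + x (i+1) + ⋯ + x (j-1)`. -/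
def psum (n : ℕ) (x : Fin n → ℝ) (i j : Fin (n + 1)) : ℝ :=
  ∑ k : Fin n, if (i : ℕ) ≤ (k : ℕ) ∧ (k : ℕ) < (j : ℕ) then x k else 0

/-- The level count `lev(π)_j`. -/
def lev (n : ℕ) (π : Equiv.Perm (Fin (n + 1))) (j : Fin n) : ℕ :=
  (Finset.univ.filter fun i : Fin n =>
    ((π i.castSucc : ℕ) ≤ (j : ℕ) ∧ (j : ℕ) < (π i.succ : ℕ)) ∨
    ((π i.succ : ℕ) ≤ (j : ℕ) ∧ (j : ℕ) < (π i.castSucc : ℕ))).card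

/-- The polytope of steps `P_π`. -/
def Ppoly (n : ℕ) (π : Equiv.Perm (Fin (n + 1))) : Set (Fin n → ℝ) :=
  {x | (∀ i, 0 ≤ x i) ∧ ∀ i : Fin n,
    psum n x (min (π i.castSucc) (π i.succ)) (max (π i.castSucc) (π i.succ)) ≤ 1}

/-- The set of positive roots, identified with pairs `i < j`. -/
def PosRoot (n : ℕ) := {p : Fin (n + 1) × Fin (n + 1) // p.1 < p.2}

/-- The Shi condition for an alcove address. -/
def Shi (n : ℕ) (k : PosRoot n → ℤ) : Prop :=
  ∀ (i t j : Fin (n + 1)) (hit : i < t) (htj : t < j),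
    k ⟨(i, t), hit⟩ + k ⟨(t, j), htj⟩ ≤ k ⟨(i, j), hit.trans htj⟩ ∧
    k ⟨(i, j), hit.trans htj⟩ ≤ k ⟨(i, t), hit⟩ + k ⟨(t, j), htj⟩ + 1

/-- The alcove with address `k`, in step coordinates. -/
def alcove (n : ℕ) (k : PosRoot n → ℤ) : Set (Fin n → ℝ) :=
  {x | ∀ p : PosRoot n,
    (k p : ℝ) < psum n x p.1.1 p.1.2 ∧ psum n x p.1.1 p.1.2 < (k p : ℝ) + 1}

/-- The root ideal `I_π`. -/
def rootIdeal (n : ℕ) (π : Equiv.Perm (Fin (n + 1))) : Set (PosRoot n) :=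
  {p | ∃ c : Fin n,
    min (π c.castSucc : ℕ) (π c.succ : ℕ) ≤ (p.1.1 : ℕ) ∧
    (p.1.2 : ℕ) ≤ max (π c.castSucc : ℕ) (π c.succ : ℕ)}

/-- The level count matrix `lev(π)_{i,j}`. -/
def lev2 (n : ℕ) (π : Equiv.Perm (Fin (n + 1))) (i j : Fin n) : ℕ :=
  (Finset.univ.filter fun k : Fin n =>
    ((π k.castSucc : ℕ) ≤ (i : ℕ) ∧ (π k.castSucc : ℕ) ≤ (j : ℕ) ∧
     (i : ℕ) < (π k.succ : ℕ) ∧ (j : ℕ) < (π k.succ : ℕ)) ∨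
    ((π k.succ : ℕ) ≤ (i : ℕ) ∧ (π k.succ : ℕ) ≤ (j : ℕ) ∧
     (i : ℕ) < (π k.castSucc : ℕ) ∧ (j : ℕ) < (π k.castSucc : ℕ))).card

/-- Summing the increments of `v` below level `b` telescopes. -/
theorem sum_increments_lt {n : ℕ} (v : Fin (n + 1) → ℤ) (b : Fin (n + 1)) :
    ∑ j : Fin n, (if (j : ℕ) < (b : ℕ) then 1 else 0) * (v j.succ - v j.castSucc) =
      v b - v 0 := by
  induction b using Fin.induction with
  | zero => simp
  | succ i ih =>
    have h : ∀ j : Fin n,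
        (if (j : ℕ) < (i.succ : ℕ) then (1 : ℤ) else 0) * (v j.succ - v j.castSucc) =
          (if (j : ℕ) < (i.castSucc : ℕ) then 1 else 0) * (v j.succ - v j.castSucc) +
            if j = i then v j.succ - v j.castSucc else 0 := by
      intro j
      simp only [Fin.val_succ, Fin.val_castSucc, Fin.ext_iff]
      split_ifs <;> omega
    rw [Finset.sum_congr rfl fun j _ => h j, Finset.sum_add_distrib, ih]
    simp

/-- The integer form of `L`, each entry being a difference of two indicators. -/
def intL (n : ℕ) (π : Equiv.Perm (Fin (n + 1))) : Matrix (Fin n) (Fin n) ℤ :=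
  fun i j =>
    (if (j : ℕ) < (π i.succ : ℕ) then 1 else 0) - if (j : ℕ) < (π i.castSucc : ℕ) then 1 else 0

theorem L_eq_map_intL (n : ℕ) (π : Equiv.Perm (Fin (n + 1))) :
    L n π = (intL n π).map (Int.castRingHom ℝ) := by
  ext i j
  simp only [L, intL, Matrix.map_apply]
  split_ifs <;> first | omega | simp

theorem intL_mul_intL_symm (n : ℕ) (π : Equiv.Perm (Fin (n + 1))) :
    intL n π * intL n π.symm = 1 := by
  ext i k
  have h := sum_increments_lt fun a => if (k : ℕ) < (π.symm a : ℕ) then 1 else 0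
  simp only [Matrix.mul_apply, intL, sub_mul, Finset.sum_sub_distrib] at h ⊢
  rw [h, h]
  simp only [Equiv.symm_apply_apply, Fin.val_succ, Fin.val_castSucc, Matrix.one_apply,
    Fin.ext_iff]
  split_ifs <;> omega

/-- `det L_π = ±1`. -/
theorem stmt_1 (n : ℕ) (hn : 1 ≤ n) (π : Equiv.Perm (Fin (n + 1))) :
    (L n π).det = 1 ∨ (L n π).det = -1 := by
  have h : IsUnit (intL n π).det :=
    (Matrix.isUnit_iff_isUnit_det _).1 (IsUnit.of_mul_eq_one _ (intL_mul_intL_symm n π))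
  rw [L_eq_map_intL, ← RingHom.mapMatrix_apply, ← RingHom.map_det]
  rcases Int.isUnit_iff.1 h with h | h <;> simp [h]
end
end

section
/- For every permutation π of {1,…,n+1}, the image of the open positive orthant (0,∞)^n under the linear map x ↦ L_π x equals D_π. -/
open MeasureTheory

noncomputable section

lemma walk_zero (n : ℕ) (x : Fin n → ℝ) : walk n x 0 = 0 := by
  simp [walk]

lemma walk_succ (n : ℕ) (x : Fin n → ℝ) (i : Fin n) :
    walk n x i.succ = walk n x i.castSucc + x i := by
  have hx : x i = ∑ j : Fin n, if j = i then x j else 0 := by simp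
  rw [hx, walk, walk, ← Finset.sum_add_distrib]
  refine Finset.sum_congr rfl fun j _ => ?_
  simp only [Fin.val_succ, Fin.val_castSucc, Fin.ext_iff]
  split_ifs <;> first | omega | simp

lemma walk_sub (n : ℕ) (f : Fin (n + 1) → ℝ) (i : Fin (n + 1)) :
    walk n (fun k => f k.succ - f k.castSucc) i = f i - f 0 := by
  induction i using Fin.induction with
  | zero => simp [walk_zero]
  | succ i ih => rw [walk_succ, ih]; ring

lemma walk_strictMono {n : ℕ} {x : Fin n → ℝ} (hx : ∀ i, 0 < x i) :
    StrictMono (walk n x) :=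
  Fin.strictMono_iff_lt_succ.2 fun i => by
    rw [walk_succ]
    exact lt_add_of_pos_right _ (hx i)

lemma L_mulVec (n : ℕ) (π : Equiv.Perm (Fin (n + 1))) (x : Fin n → ℝ) :
    (L n π).mulVec x =
      fun i => walk n x (π i.succ) - walk n x (π i.castSucc) := by
  ext i
  rw [walk, walk, ← Finset.sum_sub_distrib, Matrix.mulVec, dotProduct]
  refine Finset.sum_congr rfl fun j _ => ?_
  simp only [L]
  split_ifs <;> first | omega | simp

lemma walk_L_mulVec (n : ℕ) (π : Equiv.Perm (Fin (n + 1))) (x : Fin n → ℝ)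
    (i : Fin (n + 1)) :
    walk n ((L n π).mulVec x) i = walk n x (π i) - walk n x (π 0) := by
  rw [L_mulVec]
  exact walk_sub n (fun k => walk n x (π k)) i

/-- the image of the open positive orthant under `x ↦ L_π x` equals `D_π`. -/
theorem stmt_2 (n : ℕ) (hn : 1 ≤ n) (π : Equiv.Perm (Fin (n + 1))) :
    (fun x => (L n π).mulVec x) '' {x : Fin n → ℝ | ∀ i, 0 < x i} = D n π := by
  ext y
  constructor
  · rintro ⟨x, hx, rfl⟩
    have hmono := walk_strictMono hx
    refine ⟨fun i j hij h => hij ?_, fun i j => ?_⟩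
    · simp only [walk_L_mulVec, sub_left_inj] at h
      exact π.injective (hmono.injective h)
    · simp only [walk_L_mulVec, sub_lt_sub_iff_right]
      exact hmono.lt_iff_lt
  · rintro ⟨-, hy⟩
    refine ⟨fun k => walk n y (π.symm k.succ) - walk n y (π.symm k.castSucc),
      fun k => ?_, ?_⟩
    · refine sub_pos.2 ((hy _ _).2 ?_)
      simp
    · ext i
      simp only [L_mulVec, walk_sub n (fun k => walk n y (π.symm k)),
        Equiv.symm_apply_apply, walk_succ]
      ring
end
end

section
/- Let π be a permutation of {1,…,n+1} and let k : Φ⁺ → ℤ be any function. Then either A_k ⊆ P_π or A_k ∩ P_π = ∅. -/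
open MeasureTheory

noncomputable section

theorem psum_castSucc_succ (n : ℕ) (x : Fin n → ℝ) (i : Fin n) :
    psum n x i.castSucc i.succ = x i := by
  unfold psum
  rw [Finset.sum_eq_single i]
  · simp
  · intro b _ hb
    rw [if_neg]
    rintro ⟨h₁, h₂⟩
    apply hb
    ext
    simp only [Fin.val_castSucc, Fin.val_succ] at h₁ h₂
    omega
  · simp

theorem floor_psum_of_mem_alcove {n : ℕ} {k : PosRoot n → ℤ} {x : Fin n → ℝ}
    (hx : x ∈ alcove n k) (p : PosRoot n) : ⌊psum n x p.1.1 p.1.2⌋ = k p :=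
  Int.floor_eq_iff.2 ⟨(hx p).1.le, (hx p).2⟩

theorem ceil_psum_of_mem_alcove {n : ℕ} {k : PosRoot n → ℤ} {x : Fin n → ℝ}
    (hx : x ∈ alcove n k) (p : PosRoot n) : ⌈psum n x p.1.1 p.1.2⌉ = k p + 1 := by
  rw [Int.ceil_eq_iff]
  push_cast
  exact ⟨by linarith [(hx p).1], (hx p).2.le⟩

theorem mem_Ppoly_of_mem_alcove {n : ℕ} {π : Equiv.Perm (Fin (n + 1))} {k : PosRoot n → ℤ}
    {x y : Fin n → ℝ} (hx : x ∈ alcove n k) (hy : y ∈ alcove n k) (hxP : x ∈ Ppoly n π) :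
    y ∈ Ppoly n π := by
  refine ⟨fun i => ?_, fun i => ?_⟩
  · let p : PosRoot n := ⟨(i.castSucc, i.succ), Fin.castSucc_lt_succ⟩
    have h := hxP.1 i
    rw [← psum_castSucc_succ n x i, ← Int.floor_nonneg] at h
    rw [← psum_castSucc_succ n y i, ← Int.floor_nonneg]
    exact (floor_psum_of_mem_alcove hy p).symm ▸ floor_psum_of_mem_alcove hx p ▸ h
  · have hne : π i.castSucc ≠ π i.succ := π.injective.ne Fin.castSucc_lt_succ.ne
    let p : PosRoot n := ⟨(min (π i.castSucc) (π i.succ), max (π i.castSucc) (π i.succ)),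
      min_lt_max.2 hne⟩
    have h := hxP.2 i
    rw [← Int.cast_one, ← Int.ceil_le] at h ⊢
    exact (ceil_psum_of_mem_alcove hy p).symm ▸ ceil_psum_of_mem_alcove hx p ▸ h

/-- every alcove is contained in `P_π` or disjoint from it. -/
theorem stmt_11 (n : ℕ) (hn : 1 ≤ n) (π : Equiv.Perm (Fin (n + 1)))
    (k : PosRoot n → ℤ) :
    alcove n k ⊆ Ppoly n π ∨ alcove n k ∩ Ppoly n π = ∅ := by
  by_cases h : (alcove n k ∩ Ppoly n π).Nonempty
  · obtain ⟨x, hx, hxP⟩ := h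
    exact Or.inl fun y hy => mem_Ppoly_of_mem_alcove hx hy hxP
  · exact Or.inr (Set.not_nonempty_iff_eq_empty.1 h)
end
end

section
/- If k : Φ⁺ → ℤ satisfies the Shi condition, then the Lebesgue measure of the alcove A_k ⊆ ℝ^n equals 1/n!. -/
open MeasureTheory

noncomputable section

/-- A strict total order on `Fin n` is the pullback of the usual one along a permutation. -/
theorem exists_perm_iff_lt_of_strict_total {n : ℕ} (r : Fin n → Fin n → Prop)
    (irrefl : ∀ i, ¬ r i i) (trans : ∀ i j l, r i j → r j l → r i l)
    (total : ∀ i j, i ≠ j → r i j ∨ r j i) :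
    ∃ ρ : Equiv.Perm (Fin n), ∀ i j, r i j ↔ ρ i < ρ j := by
  classical
  let f : Fin n → Fin n := fun i => ⟨(Finset.univ.filter (r · i)).card, by
    have h : (Finset.univ.filter (r · i)).card < (Finset.univ : Finset (Fin n)).card :=
      Finset.card_lt_card (Finset.ssubset_univ_iff.mpr fun h =>
        irrefl i (Finset.mem_filter.mp
          (h.symm ▸ Finset.mem_univ i : i ∈ Finset.univ.filter (r · i))).2)
    rwa [Finset.card_fin] at h⟩
  have mono : ∀ i j, r i j → f i < f j := fun i j hij => by
    refine Fin.mk_lt_mk.mpr (Finset.card_lt_card (Finset.ssubset_iff_of_subset ?_ |>.mpr ?_))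
    · intro l hl
      simp only [Finset.mem_filter, Finset.mem_univ, true_and] at hl ⊢
      exact trans _ _ _ hl hij
    · exact ⟨i, by simpa using hij, by simpa using irrefl i⟩
  have inj : Function.Injective f := fun i j hij => by
    by_contra hne
    rcases total i j hne with h | h
    · exact (mono _ _ h).ne hij
    · exact (mono _ _ h).ne' hij
  refine ⟨Equiv.ofBijective f (Finite.injective_iff_bijective.mp inj), fun i j => ⟨mono i j, ?_⟩⟩
  intro h
  change f i < f j at h
  by_contra hr
  rcases eq_or_ne i j with rfl | hne
  · exact h.false
  · exact (mono _ _ ((total i j hne).resolve_left hr)).not_gt h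

/-- The points of the open unit cube whose coordinates are ordered as prescribed by `ρ`. -/
def orderChamber (n : ℕ) (ρ : Equiv.Perm (Fin n)) : Set (Fin n → ℝ) :=
  {u | (∀ i, u i ∈ Set.Ioo (0 : ℝ) 1) ∧ ∀ i j, ρ i < ρ j → u i < u j}

theorem isOpen_orderChamber (n : ℕ) (ρ : Equiv.Perm (Fin n)) : IsOpen (orderChamber n ρ) := by
  simp only [orderChamber, Set.mem_Ioo, Set.ofPred_and, Set.ofPred_forall]
  refine IsOpen.inter (isOpen_iInter_of_finite fun i => ?_)
    (isOpen_iInter_of_finite fun i => isOpen_iInter_of_finite fun j =>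
      isOpen_iInter_of_finite fun _ => ?_)
  · exact (isOpen_lt (by fun_prop) (by fun_prop)).inter (isOpen_lt (by fun_prop) (by fun_prop))
  · exact isOpen_lt (by fun_prop) (by fun_prop)

theorem lt_iff_of_mem_orderChamber {n : ℕ} {ρ : Equiv.Perm (Fin n)} {u : Fin n → ℝ}
    (hu : u ∈ orderChamber n ρ) (i j : Fin n) : u i < u j ↔ ρ i < ρ j := by
  refine ⟨fun h => ?_, hu.2 i j⟩
  by_contra hρ
  rcases (not_lt.mp hρ).lt_or_eq with h' | h'
  · exact (hu.2 _ _ h').not_gt h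
  · exact h.ne (congrArg u (ρ.injective h'.symm))

theorem pairwise_disjoint_orderChamber (n : ℕ) :
    Pairwise (Function.onFun Disjoint (orderChamber n)) := by
  intro ρ τ hne
  refine Set.disjoint_left.mpr fun u hρ hτ => hne ?_
  have h : ∀ i j, ρ i < ρ j ↔ τ i < τ j := fun i j =>
    (lt_iff_of_mem_orderChamber hρ i j).symm.trans (lt_iff_of_mem_orderChamber hτ i j)
  let e : Fin n ≃o Fin n :=
    { toEquiv := τ.symm.trans ρ
      map_rel_iff' := by
        intro a b
        have := h (τ.symm b) (τ.symm a)
        simp only [Equiv.apply_symm_apply] at this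
        simpa [not_lt] using not_congr this }
  ext i
  have : e (τ i) = τ i := by rw [Subsingleton.elim e (OrderIso.refl _)]; rfl
  simpa [e] using congrArg Fin.val this

theorem volume_orderChamber_eq (n : ℕ) (ρ : Equiv.Perm (Fin n)) :
    volume (orderChamber n ρ) = volume (orderChamber n 1) := by
  have hp := volume_measurePreserving_piCongrLeft (fun _ : Fin n => ℝ) ρ
  rw [← hp.measure_preimage (isOpen_orderChamber n 1).measurableSet.nullMeasurableSet]
  congr 1
  ext u
  have key : ∀ i, MeasurableEquiv.piCongrLeft (fun _ : Fin n => ℝ) ρ u (ρ i) = u i := fun i =>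
    MeasurableEquiv.piCongrLeft_apply_apply (β := fun _ : Fin n => ℝ) ρ u i
  simp only [orderChamber, Set.mem_preimage, Set.mem_ofPred_eq, Equiv.Perm.one_apply]
  exact and_congr (ρ.forall_congr fun {i} => by rw [key])
    (ρ.forall_congr fun {i} => ρ.forall_congr fun {j} => by rw [key, key])

theorem ae_injective (n : ℕ) : ∀ᵐ u : Fin n → ℝ, Function.Injective u := by
  have h : ∀ i j : Fin n, ∀ᵐ u : Fin n → ℝ, i ≠ j → u i ≠ u j := by
    intro i j
    by_cases hij : i = j
    · simp [hij]
    let W : Submodule ℝ (Fin n → ℝ) :=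
      LinearMap.ker (LinearMap.proj (R := ℝ) (φ := fun _ : Fin n => ℝ) i - LinearMap.proj j)
    have hW : W ≠ ⊤ := fun h => by
      have : Pi.single i 1 ∈ W := h ▸ Submodule.mem_top
      simp [W, hij] at this
    refine measure_mono_null (fun u hu => ?_) (Measure.addHaar_submodule volume W hW)
    simp only [Set.mem_compl_iff, Set.mem_ofPred_eq, Classical.not_imp, not_not] at hu
    simp [W, hu.2]
  filter_upwards [ae_all_iff.mpr fun i => ae_all_iff.mpr (h i)] with u hu i j hij
  by_contra hne
  exact hu i j hne hij

theorem volume_orderChamber (n : ℕ) (ρ : Equiv.Perm (Fin n)) :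
    volume (orderChamber n ρ) = 1 / (n.factorial : ENNReal) := by
  have hcube : volume (⋃ τ, orderChamber n τ) = 1 := by
    have : volume (Set.pi Set.univ fun _ : Fin n => Set.Ioo (0 : ℝ) 1) = 1 := by
      simp [Real.volume_pi_Ioo]
    rw [← this]
    refine measure_congr ?_
    filter_upwards [ae_injective n] with u hu
    refine propext ⟨fun h => ?_, fun h => ?_⟩
    · obtain ⟨τ, hτ⟩ := Set.mem_iUnion.mp h
      exact fun i _ => hτ.1 i
    · refine Set.mem_iUnion.mpr ⟨(Tuple.sort u)⁻¹, fun i => h i trivial, fun i j hij => ?_⟩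
      have hm : StrictMono (u ∘ Tuple.sort u) :=
        (Tuple.monotone_sort u).strictMono_of_injective (hu.comp (Tuple.sort u).injective)
      simpa using hm hij
  rw [measure_iUnion (pairwise_disjoint_orderChamber n)
    fun τ => (isOpen_orderChamber n τ).measurableSet] at hcube
  simp only [volume_orderChamber_eq n, tsum_fintype, Finset.sum_const, Finset.card_univ,
    Fintype.card_perm, Fintype.card_fin, nsmul_eq_mul] at hcube
  rw [volume_orderChamber_eq, one_div]
  exact ENNReal.eq_inv_of_mul_eq_one_left (by rwa [mul_comm])

theorem psum_eq_walk_sub_walk (n : ℕ) (x : Fin n → ℝ) {i j : Fin (n + 1)} (h : i ≤ j) :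
    psum n x i j = walk n x j - walk n x i := by
  have : (i : ℕ) ≤ j := h
  rw [psum, walk, walk, ← Finset.sum_sub_distrib]
  refine Finset.sum_congr rfl fun l _ => ?_
  split_ifs <;> first | omega | simp

/-- The unitriangular matrix of partial sums. -/
def partialSumMatrix (n : ℕ) : Matrix (Fin n) (Fin n) ℝ :=
  fun i j => if j ≤ i then 1 else 0

theorem det_partialSumMatrix (n : ℕ) : (partialSumMatrix n).det = 1 := by
  rw [Matrix.det_of_isLowerTriangular]
  · simp [partialSumMatrix]
  · intro i j hij
    have : i < j := hij
    simp [partialSumMatrix, this]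

theorem toLin'_partialSumMatrix_apply (n : ℕ) (x : Fin n → ℝ) (i : Fin n) :
    Matrix.toLin' (partialSumMatrix n) x i = walk n x i.succ := by
  simp only [Matrix.toLin'_apply, Matrix.mulVec, dotProduct, partialSumMatrix, walk,
    Fin.val_succ, Nat.lt_succ_iff, Fin.le_def, ite_mul, one_mul, zero_mul]

theorem volume_preimage_walk_sub (n : ℕ) (a : Fin n → ℝ) (s : Set (Fin n → ℝ)) :
    volume {x | (fun i => walk n x i.succ - a i) ∈ s} = volume s := by
  have hdet : LinearMap.det (Matrix.toLin' (partialSumMatrix n)) = 1 := by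
    rw [LinearMap.det_toLin', det_partialSumMatrix]
  calc volume {x | (fun i => walk n x i.succ - a i) ∈ s}
      = volume (Matrix.toLin' (partialSumMatrix n) ⁻¹' ((fun y => y + -a) ⁻¹' s)) := by
        congr 1
        ext x
        have : (fun i => walk n x i.succ - a i)
            = Matrix.toLin' (partialSumMatrix n) x + -a := by
          ext i
          rw [Pi.add_apply, toLin'_partialSumMatrix_apply, Pi.neg_apply, sub_eq_add_neg]
        simp only [Set.mem_ofPred_eq, Set.mem_preimage, this]
    _ = volume s := by
        rw [Measure.addHaar_preimage_linearMap _ (by simp [hdet]), hdet, measure_preimage_add_right]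
        simp

/-- The order on coordinates induced by an alcove address. -/
def addressLT (n : ℕ) (k : PosRoot n → ℤ) (i j : Fin n) : Prop :=
  (∃ h : i < j, k ⟨(0, j.succ), j.succ_pos⟩ =
    k ⟨(0, i.succ), i.succ_pos⟩ + k ⟨(i.succ, j.succ), Fin.succ_lt_succ_iff.mpr h⟩) ∨
  (∃ h : j < i, k ⟨(0, i.succ), i.succ_pos⟩ =
    k ⟨(0, j.succ), j.succ_pos⟩ + k ⟨(j.succ, i.succ), Fin.succ_lt_succ_iff.mpr h⟩ + 1)

theorem exists_perm_iff_addressLT (n : ℕ) (k : PosRoot n → ℤ) (hk : Shi n k) :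
    ∃ ρ : Equiv.Perm (Fin n), ∀ i j, addressLT n k i j ↔ ρ i < ρ j := by
  have hS : ∀ (i j : Fin n) (h : i < j), _ := fun i j h =>
    hk 0 i.succ j.succ i.succ_pos (Fin.succ_lt_succ_iff.mpr h)
  have hT : ∀ (i t j : Fin n) (h : i < t) (h' : t < j), _ := fun i t j h h' =>
    hk i.succ t.succ j.succ (Fin.succ_lt_succ_iff.mpr h) (Fin.succ_lt_succ_iff.mpr h')
  refine exists_perm_iff_lt_of_strict_total _ ?_ ?_ ?_
  · rintro i (⟨h, -⟩ | ⟨h, -⟩) <;> exact h.false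
  · rintro i j l (⟨h, e⟩ | ⟨h, e⟩) (⟨h', e'⟩ | ⟨h', e'⟩)
    · exact Or.inl ⟨h.trans h', by have := hT _ _ _ h h'; have := hS _ _ (h.trans h'); omega⟩
    · rcases lt_trichotomy i l with g | rfl | g
      · exact Or.inl ⟨g, by have := hT _ _ _ g h'; have := hS _ _ g; omega⟩
      · omega
      · exact Or.inr ⟨g, by have := hT _ _ _ g h; have := hS _ _ g; omega⟩
    · rcases lt_trichotomy i l with g | rfl | g
      · exact Or.inl ⟨g, by have := hT _ _ _ h g; have := hS _ _ g; omega⟩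
      · omega
      · exact Or.inr ⟨g, by have := hT _ _ _ h' g; have := hS _ _ g; omega⟩
    · exact Or.inr ⟨h'.trans h, by have := hT _ _ _ h' h; have := hS _ _ (h'.trans h); omega⟩
  · intro i j hne
    rcases hne.lt_or_gt with h | h
    · have := hS _ _ h
      by_cases e : k ⟨(0, j.succ), j.succ_pos⟩ =
        k ⟨(0, i.succ), i.succ_pos⟩ + k ⟨(i.succ, j.succ), Fin.succ_lt_succ_iff.mpr h⟩
      · exact Or.inl (Or.inl ⟨h, e⟩)
      · exact Or.inr (Or.inr ⟨h, by omega⟩)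
    · have := hS _ _ h
      by_cases e : k ⟨(0, i.succ), i.succ_pos⟩ =
        k ⟨(0, j.succ), j.succ_pos⟩ + k ⟨(j.succ, i.succ), Fin.succ_lt_succ_iff.mpr h⟩
      · exact Or.inr (Or.inl ⟨h, e⟩)
      · exact Or.inl (Or.inr ⟨h, by omega⟩)

theorem mem_alcove_iff_mem_orderChamber (n : ℕ) (k : PosRoot n → ℤ) (hk : Shi n k)
    (ρ : Equiv.Perm (Fin n)) (hρ : ∀ i j, addressLT n k i j ↔ ρ i < ρ j) (x : Fin n → ℝ) :
    x ∈ alcove n k ↔ (fun i : Fin n =>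
      walk n x i.succ - (k ⟨(0, i.succ), i.succ_pos⟩ : ℝ)) ∈ orderChamber n ρ := by
  have h0 : walk n x 0 = 0 := by simp [walk]
  have hdiff : ∀ p : PosRoot n, psum n x p.1.1 p.1.2 = walk n x p.1.2 - walk n x p.1.1 :=
    fun p => psum_eq_walk_sub_walk n x p.2.le
  simp only [alcove, orderChamber, Set.mem_ofPred_eq, hdiff, ← hρ, Set.mem_Ioo]
  constructor
  · intro hx
    refine ⟨fun i => ?_, ?_⟩
    · have := hx ⟨(0, i.succ), i.succ_pos⟩
      dsimp only at this
      constructor <;> linarith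
    · rintro i j (⟨h, e⟩ | ⟨h, e⟩)
      · have := hx ⟨(i.succ, j.succ), Fin.succ_lt_succ_iff.mpr h⟩
        dsimp only at this
        have e' := congrArg (Int.cast (R := ℝ)) e
        push_cast at e'
        linarith
      · have := hx ⟨(j.succ, i.succ), Fin.succ_lt_succ_iff.mpr h⟩
        dsimp only at this
        have e' := congrArg (Int.cast (R := ℝ)) e
        push_cast at e'
        linarith
  · rintro ⟨hc, ho⟩ ⟨⟨i, j⟩, hij⟩
    dsimp only at hij ⊢
    obtain ⟨j, rfl⟩ := Fin.exists_succ_eq.mpr (Fin.ne_zero_of_lt hij)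
    have hj := hc j
    rcases Fin.eq_zero_or_eq_succ i with rfl | ⟨i, rfl⟩
    · constructor <;> linarith
    · have hi := hc i
      have h := Fin.succ_lt_succ_iff.mp hij
      have hS := hk 0 i.succ j.succ i.succ_pos hij
      by_cases e : k ⟨(0, j.succ), j.succ_pos⟩ =
        k ⟨(0, i.succ), i.succ_pos⟩ + k ⟨(i.succ, j.succ), hij⟩
      · have := ho i j (Or.inl ⟨h, e⟩)
        have e' := congrArg (Int.cast (R := ℝ)) e
        push_cast at e'
        constructor <;> linarith
      · have e : k ⟨(0, j.succ), j.succ_pos⟩ =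
          k ⟨(0, i.succ), i.succ_pos⟩ + k ⟨(i.succ, j.succ), hij⟩ + 1 := by omega
        have := ho j i (Or.inr ⟨h, e⟩)
        have e' := congrArg (Int.cast (R := ℝ)) e
        push_cast at e'
        constructor <;> linarith

/-- an alcove whose address satisfies the Shi condition has volume `1/n!`. -/
theorem stmt_12 (n : ℕ) (hn : 1 ≤ n) (k : PosRoot n → ℤ) (hk : Shi n k) :
    volume (alcove n k) = 1 / (n.factorial : ENNReal) := by
  obtain ⟨ρ, hρ⟩ := exists_perm_iff_addressLT n k hk
  rw [← volume_orderChamber n ρ,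
    ← volume_preimage_walk_sub n (fun i => (k ⟨(0, i.succ), i.succ_pos⟩ : ℝ)) (orderChamber n ρ)]
  exact congrArg volume (Set.ext (mem_alcove_iff_mem_orderChamber n k hk ρ hρ))
end
end

section
/- Let I ⊆ Φ⁺ be down-closed (if (i,j) ∈ I and i ≤ i' < j' ≤ j then (i',j') ∈ I) and contain (j, j+1) for every j ∈ {1,…,n}. For (i,j) ∈ Φ⁺, define k_I(i,j) to be the least integer m ≥ 0 such that there exist integers i = t_0 < t_1 < ⋯ < t_{m+1} = j with (t_l, t_{l+1}) ∈ I for all 0 ≤ l ≤ m. Then: (a) k_I satisfies the Shi condition; (b) k_I(i,j) = 0 for all (i,j) ∈ I; and (c) every function k : Φ⁺ → ℤ that is nonnegative, satisfies the Shi condition, and vanishes on I satisfies k(i,j) ≤ k_I(i,j) for all (i,j) ∈ Φ⁺. -/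
open MeasureTheory

noncomputable section

/-- The set of integers `m ≥ 0` such that `p` can be reached from `i` to `j` via a chain
`i = t_0 < t_1 < ⋯ < t_{m+1} = j` with all consecutive pairs in `I`. -/
def chainVals (n : ℕ) (I : Set (PosRoot n)) (p : PosRoot n) : Set ℤ :=
  {m | ∃ mm : ℕ, m = (mm : ℤ) ∧
    ∃ t : Fin (mm + 2) → Fin (n + 1), StrictMono t ∧
      t 0 = p.1.1 ∧ t (Fin.last (mm + 1)) = p.1.2 ∧
      ∀ l : Fin (mm + 1), ∃ h : t l.castSucc < t l.succ,
        (⟨(t l.castSucc, t l.succ), h⟩ : PosRoot n) ∈ I}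

/-- `ChainOf n I m i j` says that `j` can be reached from `i` by `m + 1` steps in `I`. -/
inductive ChainOf (n : ℕ) (I : Set (PosRoot n)) : ℕ → Fin (n + 1) → Fin (n + 1) → Prop
  | single {i j : Fin (n + 1)} (h : i < j) (hI : (⟨(i, j), h⟩ : PosRoot n) ∈ I) :
      ChainOf n I 0 i j
  | snoc {m : ℕ} {i t j : Fin (n + 1)} (c : ChainOf n I m i t) (h : t < j)
      (hI : (⟨(t, j), h⟩ : PosRoot n) ∈ I) : ChainOf n I (m + 1) i j

namespace ChainOf

variable {n : ℕ} {I : Set (PosRoot n)}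

theorem lt {m : ℕ} {i j : Fin (n + 1)} (c : ChainOf n I m i j) : i < j := by
  induction c with
  | single h _ => exact h
  | snoc _ h _ ih => exact ih.trans h

theorem append {a b : ℕ} {i t j : Fin (n + 1)} (c : ChainOf n I a i t)
    (d : ChainOf n I b t j) : ChainOf n I (a + b + 1) i j := by
  induction d with
  | single h hI => exact c.snoc h hI
  | snoc _ h hI ih => exact (ih c).snoc h hI

theorem split
    (hdown : ∀ p ∈ I, ∀ q : PosRoot n, p.1.1 ≤ q.1.1 → q.1.2 ≤ p.1.2 → q ∈ I)
    {m : ℕ} {i j : Fin (n + 1)} (c : ChainOf n I m i j) {t : Fin (n + 1)}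
    (hit : i < t) (htj : t < j) :
    ∃ a b, ChainOf n I a i t ∧ ChainOf n I b t j ∧ a + b ≤ m := by
  induction c with
  | single h hI =>
    exact ⟨0, 0, single hit (hdown _ hI ⟨(_, t), hit⟩ le_rfl htj.le),
      single htj (hdown _ hI ⟨(t, _), htj⟩ hit.le le_rfl), le_rfl⟩
  | @snoc m i s j c h hI ih =>
    rcases lt_trichotomy t s with hts | rfl | hst
    · obtain ⟨a, b, ca, cb, hab⟩ := ih hit hts
      exact ⟨a, b + 1, ca, cb.snoc h hI, by omega⟩
    · exact ⟨m, 0, c, single h hI, by omega⟩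
    · exact ⟨m + 1, 0, c.snoc hst (hdown _ hI ⟨(s, t), hst⟩ le_rfl htj.le),
        single htj (hdown _ hI ⟨(t, j), htj⟩ hst.le le_rfl), le_rfl⟩

theorem le_of_shi {k : PosRoot n → ℤ} (hk : Shi n k) (hkI : ∀ p ∈ I, k p = 0)
    {m : ℕ} {i j : Fin (n + 1)} (c : ChainOf n I m i j) : k ⟨(i, j), c.lt⟩ ≤ m := by
  induction c with
  | single h hI => exact (hkI _ hI).le
  | snoc c h hI ih =>
    have h₁ := (hk _ _ _ c.lt h).2
    have h₂ := hkI _ hI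
    push_cast
    linarith

theorem of_strictMono {m : ℕ} (t : Fin (m + 2) → Fin (n + 1))
    (h : ∀ l : Fin (m + 1), ∃ h : t l.castSucc < t l.succ,
      (⟨(t l.castSucc, t l.succ), h⟩ : PosRoot n) ∈ I) :
    ChainOf n I m (t 0) (t (Fin.last (m + 1))) := by
  induction m with
  | zero =>
    obtain ⟨h₀, hI⟩ := h 0
    exact single h₀ hI
  | succ m ih =>
    obtain ⟨h₀, hI⟩ := h (Fin.last (m + 1))
    exact (ih (fun l => t l.castSucc) fun l => h l.castSucc).snoc h₀ hI

theorem exists_strictMono {m : ℕ} {i j : Fin (n + 1)} (c : ChainOf n I m i j) :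
    ∃ t : Fin (m + 2) → Fin (n + 1), t 0 = i ∧ t (Fin.last (m + 1)) = j ∧
      ∀ l : Fin (m + 1), ∃ h : t l.castSucc < t l.succ,
        (⟨(t l.castSucc, t l.succ), h⟩ : PosRoot n) ∈ I := by
  induction c with
  | @single i j h hI =>
    refine ⟨![i, j], rfl, rfl, fun l => ?_⟩
    obtain rfl : l = 0 := Fin.eq_zero l
    exact ⟨h, hI⟩
  | @snoc m i s j c h hI ih =>
    obtain ⟨t, h₀, h₁, ht⟩ := ih
    refine ⟨Fin.snoc (α := fun _ => Fin (n + 1)) t j, ?_, Fin.snoc_last _ _, fun l => ?_⟩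
    · rw [← Fin.castSucc_zero, Fin.snoc_castSucc, h₀]
    · induction l using Fin.lastCases with
      | last => simpa only [Fin.snoc_castSucc, Fin.succ_last, Fin.snoc_last, h₁] using ⟨h, hI⟩
      | cast l => simpa only [Fin.succ_castSucc, Fin.snoc_castSucc] using ht l

end ChainOf

theorem mem_chainVals_iff {n : ℕ} {I : Set (PosRoot n)} {p : PosRoot n} {v : ℤ} :
    v ∈ chainVals n I p ↔ ∃ m : ℕ, v = m ∧ ChainOf n I m p.1.1 p.1.2 := by
  refine exists_congr fun m => and_congr_right fun _ => ⟨?_, fun c => ?_⟩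
  · rintro ⟨t, -, h₀, h₁, ht⟩
    exact h₀ ▸ h₁ ▸ ChainOf.of_strictMono t ht
  · obtain ⟨t, h₀, h₁, ht⟩ := c.exists_strictMono
    exact ⟨t, Fin.strictMono_iff_lt_succ.2 fun l => (ht l).1, h₀, h₁, ht⟩

/-- Sommers' lemma: `k_I` satisfies the Shi condition, vanishes on `I`, and is
the unique maximum among nonnegative Shi addresses vanishing on `I`. -/
theorem stmt_15 (n : ℕ) (hn : 1 ≤ n) (I : Set (PosRoot n))
    (hdown : ∀ p ∈ I, ∀ q : PosRoot n, p.1.1 ≤ q.1.1 → q.1.2 ≤ p.1.2 → q ∈ I)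
    (hsimple : ∀ j : Fin n,
      (⟨(j.castSucc, j.succ), j.castSucc_lt_succ⟩ : PosRoot n) ∈ I)
    (kI : PosRoot n → ℤ) (hkI : ∀ p, IsLeast (chainVals n I p) (kI p)) :
    Shi n kI ∧ (∀ p ∈ I, kI p = 0) ∧
    ∀ k : PosRoot n → ℤ, (∀ p, 0 ≤ k p) → Shi n k → (∀ p ∈ I, k p = 0) →
      ∀ p, k p ≤ kI p := by
  have attained : ∀ p, ∃ m : ℕ, kI p = m ∧ ChainOf n I m p.1.1 p.1.2 := fun p =>
    mem_chainVals_iff.1 (hkI p).1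
  have le_chain : ∀ (p : PosRoot n) (m : ℕ), ChainOf n I m p.1.1 p.1.2 → kI p ≤ m :=
    fun p m c => (hkI p).2 (mem_chainVals_iff.2 ⟨m, rfl, c⟩)
  refine ⟨fun i t j hit htj => ⟨?_, ?_⟩, fun p hp => ?_, fun k _ hk hk₀ p => ?_⟩
  · obtain ⟨m, hm, c⟩ := attained ⟨(i, j), hit.trans htj⟩
    obtain ⟨a, b, ca, cb, hab⟩ := c.split hdown hit htj
    have ha := le_chain ⟨(i, t), hit⟩ a ca
    have hb := le_chain ⟨(t, j), htj⟩ b cb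
    omega
  · obtain ⟨a, ha, ca⟩ := attained ⟨(i, t), hit⟩
    obtain ⟨b, hb, cb⟩ := attained ⟨(t, j), htj⟩
    have h := le_chain ⟨(i, j), hit.trans htj⟩ _ (ca.append cb)
    omega
  · obtain ⟨m, hm, -⟩ := attained p
    have h := le_chain p 0 (.single p.2 hp)
    omega
  · obtain ⟨m, hm, c⟩ := attained p
    exact hm ▸ c.le_of_shi hk hk₀
end
end
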